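/- Let X and Y be symmetric contravariant tensor fields on ℝ^d of orders n and m with smooth coefficients, and let X^{c*} := X_{H_X} and Y^{c*} := X_{H_Y} denote their generalized complete cotangent lifts, i.e. the Hamiltonian vector fields on ℝ^d × ℝ^d of the fiberwise-polynomial functions H_X and H_Y. Then the generalized complete cotangent lift is a Lie algebra homomorphism: [X^{c*}, Y^{c*}] = ([X,Y]_SC)^{c*} = X_{H_{[X,Y]_SC}}, where [·,·] on the left is the Jacobi–Lie bracket of vector fields and [X,Y]_SC is the Schouten concomitant of order n+m−1 with coefficients Z^{i₁…i_{n+m−1}} = n·Σ_l X^{i_{m+1}…i_{m+n−1} l} ∂Y^{i₁…i_m}/∂q^l − m·Σ_l Y^{i_{n+1}…i_{n+m−1} l} ∂X^{i₁…i_n}/∂q^l. -/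

import Mathlib

noncomputable section

/-- The fiberwise-polynomial function `H_X(q,p) = Σ_ι X^ι(q) p_{ι 0} ⋯ p_{ι (n-1)}`. -/
def Hfun (d n : ℕ) (X : (Fin d → ℝ) → (Fin n → Fin d) → ℝ)
    (z : (Fin d → ℝ) × (Fin d → ℝ)) : ℝ :=
  ∑ ι : Fin n → Fin d, X z.1 ι * ∏ k, z.2 (ι k)

/-- Hamiltonian vector field `X_f(q,p) = (∇_p f, −∇_q f)` on `ℝ^d × ℝ^d`. -/
def Xham (d : ℕ) (f : (Fin d → ℝ) × (Fin d → ℝ) → ℝ) :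
    (Fin d → ℝ) × (Fin d → ℝ) → (Fin d → ℝ) × (Fin d → ℝ) := fun z =>
  (fun i => fderiv ℝ f z (0, Pi.single i 1), fun i => -(fderiv ℝ f z (Pi.single i 1, 0)))

/-- Jacobi–Lie bracket `[X,Y](z) = DY(z) X(z) − DX(z) Y(z)`. -/
def jacobiLie {E : Type*} [NormedAddCommGroup E] [NormedSpace ℝ E] (X Y : E → E) : E → E :=
  fun z => fderiv ℝ Y z (X z) - fderiv ℝ X z (Y z)

/-- Schouten concomitant of symmetric contravariant tensor fields. -/
def schouten (d n m : ℕ) (X : (Fin d → ℝ) → (Fin n → Fin d) → ℝ)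
    (Y : (Fin d → ℝ) → (Fin m → Fin d) → ℝ) :
    (Fin d → ℝ) → (Fin (n + m - 1) → Fin d) → ℝ := fun q ι =>
  (n : ℝ) * ∑ l : Fin d,
      X q (fun k => if h : m + (k : ℕ) < n + m - 1 then ι ⟨m + (k : ℕ), h⟩ else l) *
        fderiv ℝ
          (fun q' => Y q' (fun k => if h : (k : ℕ) < n + m - 1 then ι ⟨(k : ℕ), h⟩ else l))
          q (Pi.single l 1)
  - (m : ℝ) * ∑ l : Fin d,
      Y q (fun k => if h : n + (k : ℕ) < n + m - 1 then ι ⟨n + (k : ℕ), h⟩ else l) *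
        fderiv ℝ
          (fun q' => X q' (fun k => if h : (k : ℕ) < n + m - 1 then ι ⟨(k : ℕ), h⟩ else l))
          q (Pi.single l 1)

theorem clm_apply_eq_sum_basis {d : ℕ} (L : ((Fin d → ℝ) × (Fin d → ℝ)) →L[ℝ] ℝ)
    (w : (Fin d → ℝ) × (Fin d → ℝ)) :
    L w = ∑ l, (w.1 l * L (Pi.single l 1, 0) + w.2 l * L (0, Pi.single l 1)) := by
  have hw : w = ∑ l, (w.1 l • ((Pi.single l 1, 0) : (Fin d → ℝ) × (Fin d → ℝ))
      + w.2 l • ((0, Pi.single l 1) : (Fin d → ℝ) × (Fin d → ℝ))) := by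
    ext i <;> simp [Prod.fst_sum, Prod.snd_sum, Finset.sum_apply, Pi.single_apply]
  conv_lhs => rw [hw]
  simp only [map_sum, map_add, map_smul, smul_eq_mul]

theorem hasFDerivAt_Xham {d : ℕ} {f : (Fin d → ℝ) × (Fin d → ℝ) → ℝ} (hf : ContDiff ℝ 2 f)
    (z : (Fin d → ℝ) × (Fin d → ℝ)) :
    HasFDerivAt (Xham d f)
      ((ContinuousLinearMap.pi fun i =>
          (fderiv ℝ (fderiv ℝ f) z).flip ((0, Pi.single i 1) : (Fin d → ℝ) × (Fin d → ℝ))).prod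
        (ContinuousLinearMap.pi fun i =>
          -(fderiv ℝ (fderiv ℝ f) z).flip ((Pi.single i 1, 0) : (Fin d → ℝ) × (Fin d → ℝ)))) z := by
  have h2 : HasFDerivAt (fderiv ℝ f) (fderiv ℝ (fderiv ℝ f) z) z :=
    (((hf.fderiv_right (m := 1) (by norm_num)).differentiable (by norm_num)) z).hasFDerivAt
  have key : ∀ v, HasFDerivAt (fun z => fderiv ℝ f z v) ((fderiv ℝ (fderiv ℝ f) z).flip v) z := by
    intro v
    refine (h2.clm_apply (hasFDerivAt_const v z)).congr_fderiv ?_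
    ext <;> simp
  exact (hasFDerivAt_pi.2 fun i => key _).prodMk (hasFDerivAt_pi.2 fun i => (key _).neg)

/-- The Lie bracket of two Hamiltonian vector fields is the Hamiltonian vector field of the
derivative of the second Hamiltonian along the first vector field. -/
theorem jacobiLie_Xham {d : ℕ} {f g : (Fin d → ℝ) × (Fin d → ℝ) → ℝ}
    (hf : ContDiff ℝ 2 f) (hg : ContDiff ℝ 2 g) :
    jacobiLie (Xham d f) (Xham d g) = Xham d fun z => fderiv ℝ g z (Xham d f z) := by
  funext z
  have symm_f : ∀ v w, fderiv ℝ (fderiv ℝ f) z v w = fderiv ℝ (fderiv ℝ f) z w v :=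
    fun v w => (hf.contDiffAt.isSymmSndFDerivAt (by simp)) v w
  have symm_g : ∀ v w, fderiv ℝ (fderiv ℝ g) z v w = fderiv ℝ (fderiv ℝ g) z w v :=
    fun v w => (hg.contDiffAt.isSymmSndFDerivAt (by simp)) v w
  have hg2 : HasFDerivAt (fderiv ℝ g) (fderiv ℝ (fderiv ℝ g) z) z :=
    (((hg.fderiv_right (m := 1) (by norm_num)).differentiable (by norm_num)) z).hasFDerivAt
  have key : ∀ v, fderiv ℝ (fun z => fderiv ℝ g z (Xham d f z)) z v
      = fderiv ℝ (fderiv ℝ g) z (Xham d f z) v - fderiv ℝ (fderiv ℝ f) z (Xham d g z) v := by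
    intro v
    rw [(hg2.clm_apply (hasFDerivAt_Xham hf z)).fderiv, symm_g (Xham d f z) v,
      symm_f (Xham d g z) v, clm_apply_eq_sum_basis (fderiv ℝ (fderiv ℝ f) z v)]
    simp only [add_apply, ContinuousLinearMap.comp_apply,
      ContinuousLinearMap.flip_apply]
    rw [clm_apply_eq_sum_basis (fderiv ℝ g z), add_comm, sub_eq_add_neg,
      ← Finset.sum_neg_distrib]
    congr 1
    refine Finset.sum_congr rfl fun l _ => ?_
    simp [Xham]
    ring
  unfold jacobiLie
  rw [(hasFDerivAt_Xham hf z).fderiv, (hasFDerivAt_Xham hg z).fderiv]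
  rw [Xham.eq_1 d fun z => fderiv ℝ g z (Xham d f z)]
  simp only [key]
  ext i
  · simp
  · simp
    ring

theorem contDiff_Hfun {d n : ℕ} {X : (Fin d → ℝ) → (Fin n → Fin d) → ℝ} {r : WithTop ℕ∞}
    (hX : ∀ ι, ContDiff ℝ r (fun q => X q ι)) : ContDiff ℝ r (Hfun d n X) := by
  unfold Hfun
  refine ContDiff.sum fun ι _ => ?_
  refine ((hX ι).comp contDiff_fst).mul (contDiff_prod fun k _ => ?_)
  exact (contDiff_apply ℝ ℝ (ι k)).comp contDiff_snd

theorem fderiv_Hfun {d n : ℕ} {X : (Fin d → ℝ) → (Fin n → Fin d) → ℝ}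
    (hX : ∀ ι, Differentiable ℝ (fun q => X q ι)) (z v : (Fin d → ℝ) × (Fin d → ℝ)) :
    fderiv ℝ (Hfun d n X) z v
      = ∑ ι : Fin n → Fin d, (fderiv ℝ (fun q => X q ι) z.1 v.1 * ∏ k, z.2 (ι k)
        + X z.1 ι * ∑ k, (∏ j ∈ Finset.univ.erase k, z.2 (ι j)) * v.2 (ι k)) := by
  have hcoord : ∀ i : Fin d, HasFDerivAt (fun z : (Fin d → ℝ) × (Fin d → ℝ) => z.2 i)
      ((ContinuousLinearMap.proj i).comp (ContinuousLinearMap.snd ℝ _ _)) z := fun i =>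
    ((ContinuousLinearMap.proj (R := ℝ) (φ := fun _ : Fin d => ℝ) i).comp
      (ContinuousLinearMap.snd ℝ (Fin d → ℝ) (Fin d → ℝ))).hasFDerivAt
  have hH := HasFDerivAt.fun_sum (u := Finset.univ) (x := z) fun (ι : Fin n → Fin d) _ =>
    (((hX ι) z.1).hasFDerivAt.comp z (hasFDerivAt_fst (𝕜 := ℝ) (p := z))).mul
      (HasFDerivAt.finsetProd (u := Finset.univ) fun k _ => hcoord (ι k))
  have hH' : HasFDerivAt (Hfun d n X) _ z := hH
  rw [hH'.fderiv, sum_apply]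
  refine Finset.sum_congr rfl fun ι _ => ?_
  simp
  ring

theorem fderiv_Hfun_base {d n : ℕ} {X : (Fin d → ℝ) → (Fin n → Fin d) → ℝ}
    (hX : ∀ ι, Differentiable ℝ (fun q => X q ι)) (z : (Fin d → ℝ) × (Fin d → ℝ))
    (v : Fin d → ℝ) :
    fderiv ℝ (Hfun d n X) z (v, 0)
      = ∑ ι : Fin n → Fin d, fderiv ℝ (fun q => X q ι) z.1 v * ∏ k, z.2 (ι k) := by
  simp [fderiv_Hfun hX]

theorem fderiv_Hfun_fiber {d n : ℕ} {X : (Fin d → ℝ) → (Fin (n + 1) → Fin d) → ℝ}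
    (hX : ∀ ι, Differentiable ℝ (fun q => X q ι))
    (hXsymm : ∀ q (σ : Equiv.Perm (Fin (n + 1))) ι, X q (ι ∘ σ) = X q ι)
    (z : (Fin d → ℝ) × (Fin d → ℝ)) (l : Fin d) :
    fderiv ℝ (Hfun d (n + 1) X) z (0, Pi.single l 1)
      = (n + 1 : ℕ) * ∑ κ : Fin n → Fin d,
          X z.1 (Fin.snoc (α := fun _ => Fin d) κ l) * ∏ k, z.2 (κ k) := by
  have hlast : ∑ ι : Fin (n + 1) → Fin d, X z.1 ι *
      ((∏ j ∈ Finset.univ.erase (Fin.last n), z.2 (ι j)) *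
        (Pi.single l 1 : Fin d → ℝ) (ι (Fin.last n)))
      = ∑ κ : Fin n → Fin d, X z.1 (Fin.snoc (α := fun _ => Fin d) κ l) * ∏ k, z.2 (κ k) := by
    rw [← (Fin.snocEquiv fun _ : Fin (n + 1) => Fin d).sum_comp, Fintype.sum_prod_type,
      Finset.sum_comm]
    refine Finset.sum_congr rfl fun κ _ => ?_
    have hprod : ∀ i : Fin d, ∏ j ∈ Finset.univ.erase (Fin.last n),
        z.2 (Fin.snoc (α := fun _ => Fin d) κ i j) = ∏ k, z.2 (κ k) := by
      intro i
      have : (Finset.univ.erase (Fin.last n)) = Finset.univ.map Fin.castSuccEmb := by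
        ext j
        induction j using Fin.lastCases <;> simp [Fin.castSucc_ne_last]
      rw [this, Finset.prod_map]
      simp
    rw [Finset.sum_eq_single l]
    · simp [Fin.snocEquiv, hprod]
    · intro i _ hi
      simp [Fin.snocEquiv, hi]
    · simp
  have hall : ∀ k, ∑ ι : Fin (n + 1) → Fin d, X z.1 ι *
      ((∏ j ∈ Finset.univ.erase k, z.2 (ι j)) * (Pi.single l 1 : Fin d → ℝ) (ι k))
      = ∑ κ : Fin n → Fin d, X z.1 (Fin.snoc (α := fun _ => Fin d) κ l) * ∏ k, z.2 (κ k) := by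
    intro k
    rw [← hlast]
    refine Fintype.sum_equiv
      ((Equiv.swap k (Fin.last n)).arrowCongr (Equiv.refl (Fin d))) _ _ fun ι => ?_
    have hι : (Equiv.swap k (Fin.last n)).arrowCongr (Equiv.refl (Fin d)) ι
        = ι ∘ Equiv.swap k (Fin.last n) := by
      ext; simp [Equiv.arrowCongr]
    rw [hι, hXsymm]
    congr 2
    · refine Finset.prod_equiv (Equiv.swap k (Fin.last n)) (fun j => ?_) fun j _ => by simp
      simp [Equiv.swap_apply_eq_iff]
    · simp
  rw [fderiv_Hfun hX]
  simp only [map_zero, zero_mul, zero_add, Finset.mul_sum]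
  rw [Finset.sum_comm, Finset.sum_congr rfl fun k _ => hall k]
  simp [Finset.mul_sum]

theorem sum_mul_prod_split {d a b N : ℕ} (hN : N = a + b) (F : (Fin a → Fin d) → ℝ)
    (G : (Fin (b + 1) → Fin d) → ℝ) (p : Fin d → ℝ) (l l' : Fin d) :
    ∑ ι : Fin N → Fin d,
      G (fun k => if h : a + (k : ℕ) < N then ι ⟨a + (k : ℕ), h⟩ else l) *
        F (fun k => if h : (k : ℕ) < N then ι ⟨(k : ℕ), h⟩ else l') * ∏ k, p (ι k)
      = (∑ κ : Fin b → Fin d, G (Fin.snoc (α := fun _ => Fin d) κ l) * ∏ k, p (κ k)) *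
        ∑ κ : Fin a → Fin d, F κ * ∏ k, p (κ k) := by
  subst hN
  rw [← (Fin.appendEquiv a b).sum_comp, Fintype.sum_prod_type, Finset.sum_comm, Finset.sum_mul_sum]
  refine Finset.sum_congr rfl fun κ _ => Finset.sum_congr rfl fun μ _ => ?_
  have hG : (fun k : Fin (b + 1) => if h : a + (k : ℕ) < a + b then
      (Fin.appendEquiv a b (μ, κ)) ⟨a + (k : ℕ), h⟩ else l)
      = Fin.snoc (α := fun _ => Fin d) κ l := by
    funext k
    induction k using Fin.lastCases with
    | last => simp
    | cast k =>
      have := Fin.append_right μ κ k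
      simpa [Fin.appendEquiv, Fin.natAdd] using this
  have hF : (fun k : Fin a => if h : (k : ℕ) < a + b then
      (Fin.appendEquiv a b (μ, κ)) ⟨(k : ℕ), h⟩ else l') = μ := by
    funext k
    have := Fin.append_left μ κ k
    rw [dif_pos (by omega)]
    simpa [Fin.appendEquiv, Fin.castAdd, Fin.castLE] using this
  rw [hG, hF, Fin.prod_univ_add]
  simp [Fin.appendEquiv]
  ring

/-- One half of the Schouten concomitant, contracted with momenta. -/
theorem sum_fderiv_fiber_mul_fderiv_base {d n m N : ℕ} (hN : N = n + m - 1)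
    {X : (Fin d → ℝ) → (Fin n → Fin d) → ℝ} {Y : (Fin d → ℝ) → (Fin m → Fin d) → ℝ}
    (hX : ∀ ι, Differentiable ℝ (fun q => X q ι)) (hY : ∀ ι, Differentiable ℝ (fun q => Y q ι))
    (hXsymm : ∀ q (σ : Equiv.Perm (Fin n)) ι, X q (ι ∘ σ) = X q ι)
    (z : (Fin d → ℝ) × (Fin d → ℝ)) :
    ∑ ι : Fin N → Fin d, ((n : ℝ) * ∑ l : Fin d,
      X z.1 (fun k => if h : m + (k : ℕ) < N then ι ⟨m + (k : ℕ), h⟩ else l) *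
        fderiv ℝ (fun q => Y q (fun k => if h : (k : ℕ) < N then ι ⟨(k : ℕ), h⟩ else l))
          z.1 (Pi.single l 1)) * ∏ k, z.2 (ι k)
      = ∑ l : Fin d, fderiv ℝ (Hfun d n X) z (0, Pi.single l 1) *
          fderiv ℝ (Hfun d m Y) z (Pi.single l 1, 0) := by
  cases n with
  | zero => simp [fderiv_Hfun hX]
  | succ n =>
    simp only [fderiv_Hfun_fiber hX hXsymm, fderiv_Hfun_base hY, Finset.mul_sum, Finset.sum_mul]
    rw [Finset.sum_comm]
    refine Finset.sum_congr rfl fun l _ => ?_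
    have := sum_mul_prod_split (N := N) (a := m) (b := n) (by omega)
      (fun μ => fderiv ℝ (fun q => Y q μ) z.1 (Pi.single l 1)) (X z.1) z.2 l l
    simp only [mul_assoc, ← Finset.mul_sum] at this ⊢
    rw [this]
    simp only [Finset.sum_mul, Finset.mul_sum, mul_assoc]

theorem fderiv_Hfun_Xham_Hfun {d n m : ℕ}
    {X : (Fin d → ℝ) → (Fin n → Fin d) → ℝ} {Y : (Fin d → ℝ) → (Fin m → Fin d) → ℝ}
    (hX : ∀ ι, Differentiable ℝ (fun q => X q ι)) (hY : ∀ ι, Differentiable ℝ (fun q => Y q ι))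
    (hXsymm : ∀ q (σ : Equiv.Perm (Fin n)) ι, X q (ι ∘ σ) = X q ι)
    (hYsymm : ∀ q (σ : Equiv.Perm (Fin m)) ι, Y q (ι ∘ σ) = Y q ι)
    (z : (Fin d → ℝ) × (Fin d → ℝ)) :
    fderiv ℝ (Hfun d m Y) z (Xham d (Hfun d n X) z)
      = Hfun d (n + m - 1) (schouten d n m X Y) z := by
  rw [clm_apply_eq_sum_basis]
  simp only [Hfun.eq_1 d (n + m - 1), schouten, sub_mul, Finset.sum_sub_distrib]
  rw [sum_fderiv_fiber_mul_fderiv_base rfl hX hY hXsymm,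
    sum_fderiv_fiber_mul_fderiv_base (by omega) hY hX hYsymm, ← Finset.sum_sub_distrib]
  refine Finset.sum_congr rfl fun l _ => ?_
  simp only [Xham]
  ring

/-- The generalized complete cotangent lift `X ↦ X^{c*} = X_{H_X}` is a Lie algebra
homomorphism: `[X^{c*}, Y^{c*}] = ([X,Y]_SC)^{c*} = X_{H_{[X,Y]_SC}}`. -/
theorem stmt12 (d n m : ℕ)
    (X : (Fin d → ℝ) → (Fin n → Fin d) → ℝ) (Y : (Fin d → ℝ) → (Fin m → Fin d) → ℝ)
    (hX : ∀ ι, ContDiff ℝ (⊤ : ℕ∞) (fun q => X q ι)) (hY : ∀ ι, ContDiff ℝ (⊤ : ℕ∞) (fun q => Y q ι))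
    (hXsymm : ∀ q (σ : Equiv.Perm (Fin n)) ι, X q (ι ∘ σ) = X q ι)
    (hYsymm : ∀ q (σ : Equiv.Perm (Fin m)) ι, Y q (ι ∘ σ) = Y q ι) :
    jacobiLie (Xham d (Hfun d n X)) (Xham d (Hfun d m Y))
      = Xham d (Hfun d (n + m - 1) (schouten d n m X Y)) := by
  rw [jacobiLie_Xham (contDiff_infty.1 (contDiff_Hfun hX) 2)
    (contDiff_infty.1 (contDiff_Hfun hY) 2)]
  congr 1
  funext z
  exact fderiv_Hfun_Xham_Hfun (fun ι => (hX ι).differentiable (by simp))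
    (fun ι => (hY ι).differentiable (by simp)) hXsymm hYsymm z
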